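/- Let R(σ,D₂) = √((σ+1)/(3D₂)) · sinh((1/3) arsinh((3σ/(2(σ+1))) √(3D₂/(σ+1)))) for σ ≥ 0, D₂ > 0. Then R(0,D₂) = 0 and 0 ≤ R(σ,D₂) < 1/2 for all σ ≥ 0. -/

import Mathlib

noncomputable def Rroot (σ D₂ : ℝ) : ℝ :=
  Real.sqrt ((σ + 1) / (3 * D₂)) *
    Real.sinh ((1 / 3) * Real.arsinh ((3 * σ / (2 * (σ + 1))) *
      Real.sqrt (3 * D₂ / (σ + 1))))

theorem four_mul_sinh_third_arsinh_pow_three (x : ℝ) :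
    4 * Real.sinh ((1 / 3) * Real.arsinh x) ^ 3 + 3 * Real.sinh ((1 / 3) * Real.arsinh x) = x := by
  rw [← Real.sinh_three_mul, show 3 * (1 / 3 * Real.arsinh x) = Real.arsinh x by ring,
    Real.sinh_arsinh]

theorem Rroot_cubic {σ D₂ : ℝ} (hσ : 0 ≤ σ) (hD : 0 < D₂) :
    4 * Rroot σ D₂ ^ 3 + 3 * ((σ + 1) / (3 * D₂)) * Rroot σ D₂ =
      (σ + 1) / (3 * D₂) * (3 * σ / (2 * (σ + 1))) := by
  have hq : 0 < (σ + 1) / (3 * D₂) := by positivity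
  have hsq := Real.sq_sqrt hq.le
  have hab : Real.sqrt ((σ + 1) / (3 * D₂)) * Real.sqrt (3 * D₂ / (σ + 1)) = 1 := by
    rw [← inv_div (σ + 1) (3 * D₂), Real.sqrt_inv]
    exact mul_inv_cancel₀ (Real.sqrt_pos.2 hq).ne'
  have hs := four_mul_sinh_third_arsinh_pow_three
    ((3 * σ / (2 * (σ + 1))) * Real.sqrt (3 * D₂ / (σ + 1)))
  unfold Rroot
  generalize Real.sinh _ = s at *
  generalize Real.sqrt ((σ + 1) / (3 * D₂)) = a at *
  rw [← hsq]
  linear_combination a ^ 3 * hs + a ^ 2 * (3 * σ / (2 * (σ + 1))) * hab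

theorem Rroot_nonneg {σ D₂ : ℝ} (hσ : 0 ≤ σ) : 0 ≤ Rroot σ D₂ := by
  refine mul_nonneg (Real.sqrt_nonneg _) (Real.sinh_nonneg_iff.2 ?_)
  refine mul_nonneg (by norm_num) (Real.arsinh_nonneg_iff.2 ?_)
  positivity

theorem Rroot_lt_half {σ D₂ : ℝ} (hσ : 0 ≤ σ) (hD : 0 < D₂) : Rroot σ D₂ < 1 / 2 := by
  by_contra! h
  have hq : 0 < (σ + 1) / (3 * D₂) := by positivity
  have hc : 3 * σ / (2 * (σ + 1)) < 3 / 2 := by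
    rw [div_lt_div_iff₀ (by positivity) (by norm_num)]
    linarith
  have hpow : 0 < Rroot σ D₂ ^ 3 := pow_pos (by linarith) 3
  linarith [Rroot_cubic hσ hD, mul_lt_mul_of_pos_left hc hq, mul_le_mul_of_nonneg_left h hq.le]

theorem stmt_9 (D₂ : ℝ) (hD : 0 < D₂) :
    Rroot 0 D₂ = 0 ∧ ∀ σ : ℝ, 0 ≤ σ → 0 ≤ Rroot σ D₂ ∧ Rroot σ D₂ < 1 / 2 :=
  ⟨by simp [Rroot], fun _ hσ => ⟨Rroot_nonneg hσ, Rroot_lt_half hσ hD⟩⟩
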